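/- Let V be a complex vector space, let R : V → V be a locally nilpotent linear endomorphism (for every v ∈ V there exists N with R^N v = 0), and let (L_j)_{j ≥ −1} be a family of linear endomorphisms of V satisfying R∘L_j − L_j∘R = (j+1)·L_{j−1} for all j ≥ 0 and R∘L_{−1} = L_{−1}∘R. Define the weight-zero operator L_wt0 : V → V by L_wt0(v) = ∑_{j ≥ −1} ((−1)^j/(j+1)!)·L_j(R^{j+1}(v)), a finite sum by local nilpotence of R. Then R ∘ L_wt0 = 0. -/

import Mathlib

/-- Applying `R` to a partial sum of the weight-zero operator telescopes to a single term. -/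
theorem map_sum_weight_zero_terms {V : Type*} [AddCommGroup V] [Module ℂ V]
    (R : Module.End ℂ V) (L : ℤ → Module.End ℂ V)
    (hLneg : R ∘ₗ L (-1) = L (-1) ∘ₗ R)
    (hL : ∀ j : ℤ, 0 ≤ j → R ∘ₗ L j - L j ∘ₗ R = ((j : ℂ) + 1) • L (j - 1))
    (v : V) (N : ℕ) :
    R (∑ n ∈ Finset.range (N + 1), ((-1 : ℂ) ^ (n + 1) / (n.factorial : ℂ)) •
        (L ((n : ℤ) - 1)) ((R ^ n) v)) =
      ((-1 : ℂ) ^ (N + 1) / (N.factorial : ℂ)) • (L ((N : ℤ) - 1)) ((R ^ (N + 1)) v) := by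
  induction N with
  | zero =>
    have h : R (L (-1) v) = L (-1) (R v) := LinearMap.congr_fun hLneg v
    simp [h]
  | succ N ih =>
    rw [Finset.sum_range_succ, map_add, ih, map_smul]
    have h := LinearMap.congr_fun (hL N (by positivity)) ((R ^ (N + 1)) v)
    simp only [LinearMap.sub_apply, LinearMap.comp_apply, LinearMap.smul_apply] at h
    have hpow : (R ^ (N + 1 + 1)) v = R ((R ^ (N + 1)) v) := by
      rw [pow_succ' R (N + 1), Module.End.mul_apply]
    have hidx : ((N + 1 : ℕ) : ℤ) - 1 = N := by push_cast; ring
    rw [hidx, hpow, sub_eq_iff_eq_add.mp h, smul_add, smul_smul, ← add_assoc, ← add_smul]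
    have hcoeff : (-1 : ℂ) ^ (N + 1) / (N.factorial : ℂ) +
        (-1 : ℂ) ^ (N + 1 + 1) / ((N + 1).factorial : ℂ) * (((N : ℤ) : ℂ) + 1) = 0 := by
      have h1 : (N.factorial : ℂ) ≠ 0 := by exact_mod_cast N.factorial_ne_zero
      have h2 : (N : ℂ) + 1 ≠ 0 := by exact_mod_cast N.succ_ne_zero
      rw [Nat.factorial_succ]
      push_cast
      field_simp
      ring
    rw [hcoeff, zero_smul, zero_add]

/-- If `R` is a locally nilpotent endomorphism of a complex vector space `V`
and `(L_j)_{j ≥ -1}` satisfies `[R, L_j] = (j+1)·L_{j-1}` for `j ≥ 0` and `[R, L_{-1}] = 0`,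
then the weight-zero operator `L_wt0 v = ∑_{j ≥ -1} ((-1)^j/(j+1)!) · L_j (R^{j+1} v)`
(reindexed by `n = j + 1 : ℕ`) satisfies `R ∘ L_wt0 = 0`. -/
theorem weight_zero_operator_lands_in_kernel
    (V : Type*) [AddCommGroup V] [Module ℂ V]
    (R : Module.End ℂ V)
    (hR : ∀ v : V, ∃ N : ℕ, (R ^ N) v = 0)
    (L : ℤ → Module.End ℂ V)
    (hLneg : R ∘ₗ L (-1) = L (-1) ∘ₗ R)
    (hL : ∀ j : ℤ, 0 ≤ j → R ∘ₗ L j - L j ∘ₗ R = ((j : ℂ) + 1) • L (j - 1))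
    (Lwt0 : V → V)
    (hLwt0 : ∀ v : V,
      Lwt0 v = ∑ᶠ n : ℕ, ((-1 : ℂ) ^ (n + 1) / (n.factorial : ℂ)) •
        (L ((n : ℤ) - 1)) ((R ^ n) v)) :
    ∀ v : V, R (Lwt0 v) = 0 := by
  intro v
  obtain ⟨N, hN⟩ := hR v
  have hzero : ∀ n, N ≤ n → (R ^ n) v = 0 := fun n hn => by
    rw [← Nat.sub_add_cancel hn, pow_add, Module.End.mul_apply, hN, map_zero]
  rw [hLwt0, finsum_eq_sum_of_support_subset (s := Finset.range (N + 1)),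
    map_sum_weight_zero_terms R L hLneg hL, hzero (N + 1) N.le_succ, map_zero, smul_zero]
  intro n hn
  by_contra h
  rw [Finset.mem_coe, Finset.mem_range, not_lt] at h
  exact hn (by simp [hzero n (by lia)])
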